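/- (Strings of coincidences, general case) Let E and F be infinite dimensional Banach spaces. Let 1 ≤ r ≤ r_1 < (cot E)*, r ≤ a ≤ a_1 < ∞ with 1/r − 1/a = 1/r_1 − 1/a_1. Then a continuous linear operator u : E → F is absolutely (a,r)-summing if and only if it is absolutely (a_1,r_1)-summing. -/

import Mathlib

open scoped ENNReal NNReal BigOperators ZeroAtInfty

noncomputable section

/-- The `k`-th Rademacher function on `[0,1]`. -/
def Rademacher (k : ℕ) (t : ℝ) : ℝ := (-1 : ℝ) ^ ⌊(2 : ℝ) ^ (k + 1) * t⌋

/-- A Banach space `E` has cotype `q` (for `2 ≤ q < ∞`). -/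
def HasCotype (q : ℝ) (E : Type*) [NormedAddCommGroup E] [NormedSpace ℝ E] : Prop :=
  2 ≤ q ∧ ∃ C > 0, ∀ (n : ℕ) (x : Fin n → E),
    (∑ k : Fin n, ‖x k‖ ^ q) ^ (1 / q) ≤
      C * (∫ t in (0:ℝ)..(1:ℝ), ‖∑ k : Fin n, Rademacher k.1 t • x k‖ ^ 2) ^ ((1:ℝ) / 2)

/-- `cot E`, the infimum of the cotypes of `E` (`∞` if `E` has no finite cotype). -/
def cot (E : Type*) [NormedAddCommGroup E] [NormedSpace ℝ E] : ℝ≥0∞ :=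
  sInf {c : ℝ≥0∞ | ∃ q : ℝ, HasCotype q E ∧ c = ENNReal.ofReal q}

/-- Conjugate exponent in `ℝ≥0∞` : `p* = p/(p-1)`, with `1* = ∞` and `∞* = 1`. -/
def conjE (p : ℝ≥0∞) : ℝ≥0∞ := 1 + 1 / (p - 1)

/-- A sequence is weakly `p`-summable. -/
def WeaklySummable {E : Type*} [NormedAddCommGroup E] [NormedSpace ℝ E]
    (p : ℝ) (x : ℕ → E) : Prop :=
  ∀ φ : E →L[ℝ] ℝ, Summable fun j => |φ (x j)| ^ p

/-- `u : E → F` is absolutely `(q,p)`-summing. -/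
def AbsolutelySumming {E F : Type*} [NormedAddCommGroup E] [NormedSpace ℝ E]
    [NormedAddCommGroup F] [NormedSpace ℝ F] (q p : ℝ) (u : E →L[ℝ] F) : Prop :=
  ∀ x : ℕ → E, WeaklySummable p x → Summable fun j => ‖u (x j)‖ ^ q

/-- The weak `ℓ_p` norm of a sequence. -/
def weakNorm {E : Type*} [NormedAddCommGroup E] [NormedSpace ℝ E] (p : ℝ) (x : ℕ → E) : ℝ :=
  ⨆ φ : {φ : E →L[ℝ] ℝ // ‖φ‖ ≤ 1}, (∑' j, |φ.1 (x j)| ^ p) ^ (1 / p)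

/-- A continuous `m`-linear operator is multiple `(q,p)`-summing. -/
def MultipleSumming {m : ℕ} {E : Fin m → Type*} [∀ i, NormedAddCommGroup (E i)]
    [∀ i, NormedSpace ℝ (E i)] {F : Type*} [NormedAddCommGroup F] [NormedSpace ℝ F]
    (q p : ℝ) (T : ContinuousMultilinearMap ℝ E F) : Prop :=
  ∃ C > 0, ∀ x : (i : Fin m) → ℕ → E i, (∀ i, WeaklySummable p (x i)) →
    (Summable fun j : Fin m → ℕ => ‖T (fun i => x i (j i))‖ ^ q) ∧
    (∑' j : Fin m → ℕ, ‖T (fun i => x i (j i))‖ ^ q) ^ (1 / q) ≤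
      C * ∏ i, weakNorm p (x i)


lemma sub_div_rpow_le {x y p : ℝ} (hx : 0 < x) (hxy : x ≤ y) (hp : 1 < p) :
    (y - x) / y ^ p ≤ (x ^ (1 - p) - y ^ (1 - p)) / (p - 1) := by
  have hy : 0 < y := hx.trans_le hxy
  have hp' : 0 < p - 1 := by linarith
  have h1 : 1 + (p - 1) * (1 - x / y) ≤ (x / y) ^ (1 - p) := by
    rw [Real.rpow_def_of_pos (by positivity)]
    have h2 := Real.add_one_le_exp (Real.log (x / y) * (1 - p))
    have h3 := Real.log_le_sub_one_of_pos (show 0 < x / y by positivity)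
    nlinarith
  rw [Real.div_rpow hx.le hy.le] at h1
  have hyp : 0 < y ^ (1 - p) := by positivity
  rw [le_div_iff₀ hyp] at h1
  have h4 : y ^ p * y ^ (1 - p) = y := by rw [← Real.rpow_add hy]; simp
  have h5 : (y - x) / y ^ p = (1 - x / y) * y ^ (1 - p) := by
    field_simp
    rw [mul_assoc, h4]
    field_simp
  rw [h5, le_div_iff₀ hp']
  linarith

/-- The convergent half of the Abel–Dini theorem. -/
lemma summable_div_partialSum_rpow {c : ℕ → ℝ} (hc : ∀ n, 0 ≤ c n) {p : ℝ} (hp : 1 < p) :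
    Summable fun n => c n / (1 + ∑ j ∈ Finset.range (n + 1), c j) ^ p := by
  have hS : ∀ n, 0 ≤ ∑ j ∈ Finset.range n, c j := fun n => Finset.sum_nonneg fun j _ => hc j
  have hp' : 0 < p - 1 := by linarith
  refine summable_of_sum_range_le (c := 1 / (p - 1)) (fun n => ?_) fun n => ?_
  · have := hS (n + 1); have := hc n; positivity
  · have : ∀ n, ∑ i ∈ Finset.range n, c i / (1 + ∑ j ∈ Finset.range (i + 1), c j) ^ p ≤
        (1 - (1 + ∑ j ∈ Finset.range n, c j) ^ (1 - p)) / (p - 1) := by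
      intro n
      induction n with
      | zero => simp
      | succ n ih =>
        rw [Finset.sum_range_succ]
        have hn := hS n
        have := sub_div_rpow_le (x := 1 + ∑ j ∈ Finset.range n, c j)
          (y := 1 + ∑ j ∈ Finset.range (n + 1), c j) (by positivity)
          (by rw [Finset.sum_range_succ]; linarith [hc n]) hp
        have e : 1 + ∑ j ∈ Finset.range (n + 1), c j - (1 + ∑ j ∈ Finset.range n, c j) = c n := by
          rw [Finset.sum_range_succ]; ring
        rw [e] at this
        calc _ ≤ _ := add_le_add ih this
          _ = _ := by ring
    refine (this n).trans ?_
    have hn := hS n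
    gcongr
    have : 0 ≤ (1 + ∑ j ∈ Finset.range n, c j) ^ (1 - p) := by positivity
    linarith

/-- The divergent half of the Abel–Dini theorem. -/
lemma summable_of_summable_div_partialSum {c : ℕ → ℝ} (hc : ∀ n, 0 ≤ c n)
    (h : Summable fun n => c n / (1 + ∑ j ∈ Finset.range (n + 1), c j)) : Summable c := by
  by_contra hns
  have hS : ∀ n, 0 ≤ ∑ j ∈ Finset.range n, c j := fun n => Finset.sum_nonneg fun j _ => hc j
  have htop := (not_summable_iff_tendsto_nat_atTop_of_nonneg hc).1 hns
  have htail := (tendsto_sum_nat_add fun n => c n / (1 + ∑ j ∈ Finset.range (n + 1), c j))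
  obtain ⟨N, hN⟩ := (htail.eventually (gt_mem_nhds (show (0 : ℝ) < 1 / 2 by norm_num))).exists
  obtain ⟨m, hm, hNm⟩ := ((htop.eventually_ge_atTop
    (2 * (∑ j ∈ Finset.range N, c j) + 2)).and (Filter.eventually_ge_atTop N)).exists
  obtain ⟨k, rfl⟩ := Nat.exists_eq_add_of_le hNm
  have hsum := (summable_nat_add_iff N).2 h
  have h1 := hsum.sum_le_tsum (Finset.range k) fun i _ => by
    have := hS (i + N + 1); have := hc (i + N); positivity
  have h2 : ∑ i ∈ Finset.range k, c (i + N) / (1 + ∑ j ∈ Finset.range (N + k), c j) ≤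
      ∑ i ∈ Finset.range k, c (i + N) / (1 + ∑ j ∈ Finset.range (i + N + 1), c j) := by
    refine Finset.sum_le_sum fun i hi => ?_
    have := hS (i + N + 1); have := hc (i + N)
    have hik := Finset.mem_range.1 hi
    refine div_le_div_of_nonneg_left this (by positivity) (add_le_add_right ?_ 1)
    exact Finset.sum_le_sum_of_subset_of_nonneg
      (Finset.range_subset_range.2 (by omega)) fun j _ _ => hc j
  rw [← Finset.sum_div] at h2
  have h3 : ∑ i ∈ Finset.range k, c (i + N) =
      ∑ j ∈ Finset.range (N + k), c j - ∑ j ∈ Finset.range N, c j := by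
    rw [Finset.sum_range_add]; simp [add_comm]
  have h4 := h2.trans (h1.trans hN.le)
  have := hS (N + k)
  rw [h3, div_le_iff₀ (by positivity)] at h4
  linarith

/-- The inclusion theorem for absolutely summing operators. -/
lemma AbsolutelySumming.mono {E F : Type*} [NormedAddCommGroup E] [NormedSpace ℝ E]
    [NormedAddCommGroup F] [NormedSpace ℝ F] {u : E →L[ℝ] F} {r r₁ a a₁ : ℝ} (hr : 0 < r)
    (hrr : r ≤ r₁) (ha : 0 < a) (ha₁ : 0 < a₁) (heq : 1 / r - 1 / a = 1 / r₁ - 1 / a₁)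
    (hu : AbsolutelySumming a r u) : AbsolutelySumming a₁ r₁ u := by
  have hr₁ : 0 < r₁ := hr.trans_le hrr
  rcases hrr.eq_or_lt with rfl | hlt
  · have : 1 / a = 1 / a₁ := by linarith
    obtain rfl : a = a₁ := by simpa using this
    exact hu
  intro x hx
  have hτ : 0 < 1 / r - 1 / r₁ := sub_pos.2 (one_div_lt_one_div_of_lt hr hlt)
  set t : ℝ := 1 / (1 / r - 1 / r₁) with ht
  have ht0 : 0 < t := by positivity
  have htr : 1 / t + 1 / r₁ = 1 / r := by rw [ht, one_div_one_div]; ring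
  have hta : 1 / t + 1 / a₁ = 1 / a := by linarith
  have hat : 1 < t / a := by
    rw [one_lt_div ha]
    refine lt_of_one_div_lt_one_div ht0 ?_
    have : 0 < 1 / a₁ := by positivity
    linarith
  set c : ℕ → ℝ := fun j => ‖u (x j)‖ ^ a₁ with hcdef
  have hc : ∀ n, 0 ≤ c n := fun n => by positivity
  refine summable_of_summable_div_partialSum hc ?_
  set S : ℕ → ℝ := fun n => 1 + ∑ j ∈ Finset.range (n + 1), c j with hSdef
  have hS : ∀ n, 0 < S n := fun n => by
    have : 0 ≤ ∑ j ∈ Finset.range (n + 1), c j := Finset.sum_nonneg fun j _ => hc j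
    simp only [hSdef]; positivity
  set l : ℕ → ℝ := fun n => (c n / S n ^ (t / a)) ^ (1 / t) with hl
  have hl0 : ∀ n, 0 ≤ l n := fun n => by have := hS n; have := hc n; simp only [hl]; positivity
  have hls : Summable fun n => l n ^ t := by
    refine (summable_div_partialSum_rpow hc hat).congr fun n => ?_
    have := hS n; have := hc n
    rw [hl, ← Real.rpow_mul (by positivity), one_div_mul_cancel ht0.ne', Real.rpow_one]
  have hw : WeaklySummable r fun j => l j • x j := by
    intro φ
    have := Real.summable_Lr_of_Lp_Lq_of_nonneg
      (show t.HolderTriple r₁ r from ⟨by simpa only [one_div] using htr, ht0, hr₁⟩) hl0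
      (fun i => abs_nonneg (φ (x i))) hls (hx φ)
    refine this.congr fun j => ?_
    rw [map_smul, smul_eq_mul, abs_mul, abs_of_nonneg (hl0 j)]
  refine (hu _ hw).congr fun j => ?_
  have h1 := hS j; have h2 := hc j
  have h3 : ‖u (x j)‖ = c j ^ (1 / a₁) := by
    rw [hcdef, ← Real.rpow_mul (norm_nonneg _), mul_one_div_cancel ha₁.ne', Real.rpow_one]
  rw [map_smul, norm_smul, Real.norm_of_nonneg (hl0 j), h3, hl]
  change ((c j / S j ^ (t / a)) ^ (1 / t) * c j ^ (1 / a₁)) ^ a = c j / S j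
  rw [Real.div_rpow h2 (by positivity), ← Real.rpow_mul h1.le, div_mul_eq_mul_div,
    ← Real.rpow_add_of_nonneg h2 (by positivity) (by positivity), hta,
    show t / a * (1 / t) = 1 / a by field_simp,
    ← Real.div_rpow h2 h1.le, ← Real.rpow_mul (by positivity), one_div_mul_cancel ha.ne',
    Real.rpow_one]

lemma abs_rademacher (k : ℕ) (t : ℝ) : |Rademacher k t| = 1 := by
  rw [Rademacher, abs_zpow]; simp

/-- A space of cotype `q` has the Orlicz property with exponent `q`. -/
lemma HasCotype.exists_sum_norm_rpow_le {q : ℝ} {E : Type*} [NormedAddCommGroup E]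
    [NormedSpace ℝ E] (h : HasCotype q E) : ∃ C : ℝ, 0 < C ∧ ∀ (n : ℕ) (y : Fin n → E) (M : ℝ),
      0 ≤ M → (∀ ε : Fin n → ℝ, (∀ i, |ε i| ≤ 1) → ‖∑ i, ε i • y i‖ ≤ M) →
        ∑ i, ‖y i‖ ^ q ≤ (C * M) ^ q := by
  obtain ⟨hq, C, hC, H⟩ := h
  have hq0 : 0 < q := by linarith
  refine ⟨C, hC, fun n y M hM hy => ?_⟩
  have hint : ∫ t in (0:ℝ)..(1:ℝ), ‖∑ k : Fin n, Rademacher k.1 t • y k‖ ^ 2 ≤ M ^ 2 := by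
    have := intervalIntegral.norm_integral_le_of_norm_le_const (a := (0 : ℝ)) (b := 1)
      (f := fun t => ‖∑ k : Fin n, Rademacher k.1 t • y k‖ ^ 2) (C := M ^ 2) fun t _ => by
        rw [Real.norm_of_nonneg (by positivity)]
        gcongr
        exact hy _ fun i => (abs_rademacher _ _).le
    simpa using (le_abs_self _).trans this
  have h0 : 0 ≤ ∑ i, ‖y i‖ ^ q := Finset.sum_nonneg fun i _ => by positivity
  have h1 : (∑ i, ‖y i‖ ^ q) ^ (1 / q) ≤ C * M := by
    refine (H n y).trans ?_
    have h2 : 0 ≤ ∫ t in (0:ℝ)..(1:ℝ), ‖∑ k : Fin n, Rademacher k.1 t • y k‖ ^ 2 :=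
      intervalIntegral.integral_nonneg zero_le_one fun t _ => by positivity
    gcongr
    rw [← Real.sqrt_eq_rpow]
    exact Real.sqrt_le_iff.2 ⟨hM, hint⟩
  calc _ = ((∑ i, ‖y i‖ ^ q) ^ (1 / q)) ^ q := by
        rw [← Real.rpow_mul h0, one_div_mul_cancel hq0.ne', Real.rpow_one]
    _ ≤ _ := by gcongr

/-- A weakly summable sequence is weakly unconditionally bounded. -/
lemma WeaklySummable.exists_norm_sum_smul_le {E : Type*} [NormedAddCommGroup E] [NormedSpace ℝ E]
    {x : ℕ → E} (hx : WeaklySummable 1 x) : ∃ M : ℝ, 0 ≤ M ∧ ∀ (n : ℕ) (f : Fin n → ℝ),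
      (∀ j, |f j| ≤ 1) → ‖∑ j, f j • x j‖ ≤ M := by
  have hx' : ∀ φ : E →L[ℝ] ℝ, Summable fun j => |φ (x j)| := by
    simpa only [WeaklySummable, Real.rpow_one] using hx
  obtain ⟨M, hM⟩ := banach_steinhaus (𝕜 := ℝ) (𝕜₂ := ℝ) (σ₁₂ := RingHom.id ℝ)
    (ι := {p : Σ n : ℕ, (Fin n → ℝ) // ∀ j, |p.2 j| ≤ 1})
    (E := StrongDual ℝ E) (F := ℝ)
    (g := fun p => NormedSpace.inclusionInDoubleDual ℝ E (∑ j, p.1.2 j • x j)) (fun φ => by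
      refine ⟨∑' j, |φ (x j)|, fun p => ?_⟩
      rw [NormedSpace.dual_def, map_sum]
      refine (norm_sum_le _ _).trans ?_
      calc ∑ j, ‖φ (p.1.2 j • x j)‖ ≤ ∑ j : Fin p.1.1, |φ (x j)| := by
            refine Finset.sum_le_sum fun j _ => ?_
            rw [map_smul, smul_eq_mul, Real.norm_eq_abs, abs_mul]
            exact mul_le_of_le_one_left (abs_nonneg _) (p.2 j)
        _ = ∑ j ∈ Finset.range p.1.1, |φ (x j)| :=
            (Finset.sum_range fun j => |φ (x j)|).symm
        _ ≤ _ := (hx' φ).sum_le_tsum _ fun _ _ => abs_nonneg _)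
  refine ⟨|M|, abs_nonneg _, fun n f hf => ?_⟩
  have := hM ⟨⟨n, f⟩, hf⟩
  have h2 := (NormedSpace.inclusionInDoubleDualLi (E := E) ℝ).norm_map (∑ j, f j • x j)
  rw [← h2]
  exact this.trans (le_abs_self M)

/-- Pisier's factorization theorem for `(q, 1)`-summing operators on a finite dimensional
`ℓ_∞`-space, up to an arbitrarily small error. -/
lemma exists_weights_norm_rpow_le {E ι : Type*} [NormedAddCommGroup E] [NormedSpace ℝ E]
    [Fintype ι] (T : (ι → ℝ) →ₗ[ℝ] E) {q K ε : ℝ} (hq : 1 < q) (hε : 0 < ε)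
    (hK : ∀ (n : ℕ) (f : Fin n → ι → ℝ), (∀ j, ∑ i, |f i j| ≤ 1) → ∑ i, ‖T (f i)‖ ^ q ≤ K) :
    ∃ μ : ι → ℝ, (∀ j, 0 ≤ μ j) ∧ ∑ j, μ j ≤ K ∧
      ∀ f : ι → ℝ, (∀ j, |f j| ≤ 1) → ‖T f‖ ^ q ≤ ε + q * ∑ j, μ j * |f j| := by
  classical
  have hq0 : 0 < q := by linarith
  set V : Set ℝ := {D | ∃ (n : ℕ) (f : Fin n → ι → ℝ), (∀ j, ∑ i, |f i j| ≤ 1) ∧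
    ∑ i, ‖T (f i)‖ ^ q = D} with hV
  have hbdd : BddAbove V := ⟨K, by rintro _ ⟨n, f, hf, rfl⟩; exact hK n f hf⟩
  have hne : V.Nonempty := ⟨0, 0, 0, by simp, by simp⟩
  have hSK : sSup V ≤ K := csSup_le hne (by rintro _ ⟨n, f, hf, rfl⟩; exact hK n f hf)
  have hS : ∀ (n : ℕ) (f : Fin n → ι → ℝ), (∀ j, ∑ i, |f i j| ≤ 1) →
      ∑ i, ‖T (f i)‖ ^ q ≤ sSup V := fun n f hf => le_csSup hbdd ⟨n, f, hf, rfl⟩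
  obtain ⟨_, ⟨n, f, hf, rfl⟩, hD⟩ := exists_lt_of_lt_csSup hne (sub_lt_self (sSup V) hε)
  set D := ∑ i, ‖T (f i)‖ ^ q with hDdef
  choose φ hφ hφT using fun i => exists_dual_vector'' ℝ (T (f i))
  set l : ι → ℝ := fun j => ∑ i, ‖T (f i)‖ ^ (q - 1) * φ i (T (Pi.single j (f i j))) with hl
  have hlsum : ∀ g : ι → ℝ, ∑ j, l j * g j =
      ∑ i, ‖T (f i)‖ ^ (q - 1) * φ i (T (f i * g)) := by
    intro g
    simp only [hl, Finset.sum_mul]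
    rw [Finset.sum_comm]
    refine Finset.sum_congr rfl fun i _ => ?_
    have : f i * g = ∑ j, g j • Pi.single (M := fun _ : ι => ℝ) j (f i j) := by
      ext k
      simp [Finset.sum_apply, Pi.single_apply, mul_comm]
    rw [this, map_sum, map_sum, Finset.mul_sum]
    refine Finset.sum_congr rfl fun j _ => ?_
    rw [map_smul, map_smul, smul_eq_mul]
    ring
  have hconj : (q / (q - 1)).HolderConjugate q :=
    (Real.HolderConjugate.conjExponent hq).symm
  have hyoung : ∀ g : ι → ℝ, ∑ j, l j * g j ≤
      (1 - 1 / q) * D + 1 / q * ∑ i, ‖T (f i * g)‖ ^ q := by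
    intro g
    rw [hlsum, hDdef, Finset.mul_sum, Finset.mul_sum, ← Finset.sum_add_distrib]
    refine Finset.sum_le_sum fun i _ => ?_
    have h1 : φ i (T (f i * g)) ≤ ‖T (f i * g)‖ :=
      (le_abs_self _).trans (((φ i).le_opNorm _).trans
        (mul_le_of_le_one_left (norm_nonneg _) (hφ i)))
    have h2 := Real.young_inequality_of_nonneg
      (Real.rpow_nonneg (norm_nonneg (T (f i))) (q - 1)) (norm_nonneg (T (f i * g))) hconj
    have hq1 : q - 1 ≠ 0 := by linarith
    rw [← Real.rpow_mul (norm_nonneg _), mul_div_cancel₀ _ hq1] at h2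
    calc _ ≤ ‖T (f i)‖ ^ (q - 1) * ‖T (f i * g)‖ := by gcongr
      _ ≤ _ := h2
      _ = _ := by field_simp
  have hDone : ∑ j, l j = D := by
    have := hlsum 1
    simp only [Pi.one_apply, mul_one] at this
    rw [this, hDdef]
    refine Finset.sum_congr rfl fun i _ => ?_
    rw [hφT]
    rcases (norm_nonneg (T (f i))).eq_or_lt with h0 | h0
    · simp [← h0, hq0.ne']
    · simp only [RCLike.ofReal_real_eq_id, id]
      rw [← Real.rpow_add_one h0.ne', sub_add_cancel]
  have hDS : D ≤ sSup V := hS n f hf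
  have hq1 : 1 / q ≤ 1 := by rw [div_le_one hq0]; exact hq.le
  refine ⟨fun j => |l j|, fun j => abs_nonneg _, ?_, fun g hg => ?_⟩
  · have h1 := hyoung fun j => SignType.sign (l j)
    simp only [mul_comm (l _), sign_mul_self] at h1
    have h2 := hS n (fun i => f i * fun j => (SignType.sign (l j) : ℝ)) fun j => by
      refine (Finset.sum_le_sum fun i _ => ?_).trans (hf j)
      simp only [Pi.mul_apply, abs_mul]
      refine mul_le_of_le_one_right (abs_nonneg _) ?_
      cases SignType.sign (l j) <;> simp
    have h3 : (1 - 1 / q) * D ≤ (1 - 1 / q) * sSup V :=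
      mul_le_mul_of_nonneg_left hDS (by linarith)
    have h4 := mul_le_mul_of_nonneg_left h2 (show 0 ≤ 1 / q by positivity)
    linarith
  · have h1 := hyoung fun j => 1 - |g j|
    have h2 := hS (n + 1) (Fin.cons g fun i => f i * fun j => 1 - |g j|) fun j => by
      have h3 : ∑ i, |f i j| * (1 - |g j|) ≤ 1 - |g j| := by
        rw [← Finset.sum_mul]
        exact mul_le_of_le_one_left (by linarith [hg j]) (hf j)
      simp only [Fin.sum_univ_succ, Fin.cons_zero, Fin.cons_succ, Pi.mul_apply, abs_mul,
        abs_of_nonneg (sub_nonneg.2 (hg j))]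
      linarith
    simp only [Fin.sum_univ_succ, Fin.cons_zero, Fin.cons_succ] at h2
    simp only [mul_sub, mul_one, Finset.sum_sub_distrib, hDone] at h1
    have h3 : ∑ j, l j * |g j| ≤ ∑ j, |l j| * |g j| :=
      Finset.sum_le_sum fun j _ => mul_le_mul_of_nonneg_right (le_abs_self _) (abs_nonneg _)
    have h4 := mul_le_mul_of_nonneg_left h1 hq0.le
    have h5 : q * ((1 - 1 / q) * D + 1 / q * ∑ i, ‖T (f i * fun j => 1 - |g j|)‖ ^ q) =
        (q - 1) * D + ∑ i, ‖T (f i * fun j => 1 - |g j|)‖ ^ q := by field_simp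
    have h6 := mul_le_mul_of_nonneg_left h3 hq0.le
    simp only [mul_sub] at h4 h5
    nlinarith

lemma sum_range_ite_lt {β : Type*} [AddCommMonoid β] (g : ℕ → β) {n m : ℕ} (hnm : n ≤ m) :
    ∑ j ∈ Finset.range m, (if j < n then g j else 0) = ∑ j ∈ Finset.range n, g j := by
  rw [← Finset.sum_subset (Finset.range_subset_range.2 hnm) fun j _ hj =>
    if_neg (by simpa using hj)]
  exact Finset.sum_congr rfl fun j hj => if_pos (Finset.mem_range.1 hj)

/-- Pisier's factorization theorem for the operator `c₀ → E` induced by a weakly summable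
sequence in a space of cotype `q`. -/
lemma HasCotype.exists_weights {q : ℝ} {E : Type*} [NormedAddCommGroup E] [NormedSpace ℝ E]
    (h : HasCotype q E) {x : ℕ → E} (hx : WeaklySummable 1 x) :
    ∃ μ : ℕ → ℝ, (∀ j, 0 ≤ μ j) ∧ Summable μ ∧ ∀ (n : ℕ) (f : ℕ → ℝ), (∀ j, |f j| ≤ 1) →
      ‖∑ j ∈ Finset.range n, f j • x j‖ ^ q ≤ q * ∑ j ∈ Finset.range n, μ j * |f j| := by
  obtain ⟨C, hC, hCy⟩ := h.exists_sum_norm_rpow_le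
  obtain ⟨M, hM, hMx⟩ := hx.exists_norm_sum_smul_le
  have hq : 1 < q := by linarith [h.1]
  set K : ℝ := (C * M) ^ q with hKdef
  have hK0 : 0 ≤ K := by positivity
  set A : ℕ → Set (ℕ → ℝ) := fun n => {μ | (∀ j, 0 ≤ μ j ∧ μ j ≤ K) ∧
    ∑ j ∈ Finset.range n, μ j ≤ K ∧ ∀ f : ℕ → ℝ, (∀ j, |f j| ≤ 1) →
      ‖∑ j ∈ Finset.range n, f j • x j‖ ^ q ≤
        1 / (n + 1) + q * ∑ j ∈ Finset.range n, μ j * |f j|} with hA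
  have hmono : ∀ n, A (n + 1) ⊆ A n := by
    rintro n μ ⟨h1, h2, h3⟩
    refine ⟨h1, ?_, fun f hf => ?_⟩
    · rw [Finset.sum_range_succ] at h2
      linarith [(h1 n).1]
    · have h4 := h3 (fun j => if j < n then f j else 0) fun j => by
        split_ifs
        · exact hf j
        · simp
      simp only [ite_smul, zero_smul, apply_ite abs, abs_zero, mul_ite, mul_zero,
        sum_range_ite_lt _ n.le_succ] at h4
      refine h4.trans ?_
      have : (1 : ℝ) / ((n + 1 : ℕ) + 1) ≤ 1 / (n + 1) := by
        push_cast
        exact one_div_le_one_div_of_le (by positivity) (by linarith)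
      linarith
  have hne : ∀ n, (A n).Nonempty := by
    intro n
    obtain ⟨μ, hμ0, hμK, hμ⟩ := exists_weights_norm_rpow_le
      (Fintype.linearCombination ℝ fun j : Fin n => x j) hq
      (show (0 : ℝ) < 1 / (n + 1) by positivity) (K := K) fun m f hf => by
        refine hCy m _ M hM fun ε hε => ?_
        simp only [← map_smul, ← map_sum]
        rw [Fintype.linearCombination_apply]
        refine hMx n _ fun j => ?_
        rw [Finset.sum_apply]
        refine (Finset.abs_sum_le_sum_abs _ _).trans
          ((Finset.sum_le_sum fun i _ => ?_).trans (hf j))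
        rw [Pi.smul_apply, smul_eq_mul, abs_mul]
        exact mul_le_of_le_one_left (abs_nonneg _) (hε i)
    refine ⟨fun j => if h : j < n then μ ⟨j, h⟩ else 0, fun j => ?_, ?_, fun f hf => ?_⟩
    · dsimp only
      split_ifs with hj
      · exact ⟨hμ0 _, (Finset.single_le_sum (fun i _ => hμ0 i) (Finset.mem_univ _)).trans hμK⟩
      · exact ⟨le_rfl, hK0⟩
    · rw [Finset.sum_range]
      simpa using hμK
    · have := hμ (fun j => f j) fun j => hf j
      rw [Fintype.linearCombination_apply] at this
      rw [Finset.sum_range, Finset.sum_range]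
      simpa using this
  have hcl : ∀ n, IsClosed (A n) := by
    intro n
    simp only [hA, Set.ofPred_and, Set.ofPred_forall]
    refine (isClosed_iInter fun j => ?_).inter (IsClosed.inter ?_ ?_)
    · exact (isClosed_le (by fun_prop) (by fun_prop)).inter
        (isClosed_le (by fun_prop) (by fun_prop))
    · exact isClosed_le (by fun_prop) (by fun_prop)
    · exact isClosed_iInter fun f => isClosed_iInter fun _ =>
        isClosed_le (by fun_prop) (by fun_prop)
  have hcpt : IsCompact (A 0) :=
    (isCompact_univ_pi fun _ : ℕ => isCompact_Icc (a := (0 : ℝ)) (b := K)).of_isClosed_subset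
      (hcl 0) fun μ hμ j _ => hμ.1 j
  obtain ⟨μ, hμ⟩ :=
    IsCompact.nonempty_iInter_of_sequence_nonempty_isCompact_isClosed A hmono hne hcpt hcl
  rw [Set.mem_iInter] at hμ
  refine ⟨μ, fun j => ((hμ 0).1 j).1,
    summable_of_sum_range_le (fun j => ((hμ 0).1 j).1) fun n => (hμ n).2.1, fun n f hf => ?_⟩
  have hlim : Filter.Tendsto (fun m : ℕ => 1 / ((m : ℝ) + 1) +
      q * ∑ j ∈ Finset.range n, μ j * |f j|) Filter.atTop
      (nhds (0 + q * ∑ j ∈ Finset.range n, μ j * |f j|)) :=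
    tendsto_one_div_add_atTop_nhds_zero_nat.add tendsto_const_nhds
  rw [zero_add] at hlim
  refine ge_of_tendsto hlim ?_
  filter_upwards [Filter.eventually_ge_atTop n] with m hm
  have h4 := (hμ m).2.2 (fun j => if j < n then f j else 0) fun j => by
    split_ifs
    · exact hf j
    · simp
  simp only [ite_smul, zero_smul, apply_ite abs, abs_zero, mul_ite, mul_zero,
    sum_range_ite_lt _ hm] at h4
  refine h4.trans ?_
  gcongr

/-- A Lorentz-type estimate `‖∑ f j • x j‖ ^ q ≤ q * ∑ μ j * |f j|` for `|f| ≤ 1` improves to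
boundedness on the unit ball of `ℓ_s(μ)` when `s > q`. -/
lemma exists_norm_sum_smul_le_of_weights {q s : ℝ} {E : Type*} [NormedAddCommGroup E]
    [NormedSpace ℝ E] {x : ℕ → E} {μ : ℕ → ℝ} (hq : 0 < q) (hqs : q < s) (hμ : ∀ j, 0 ≤ μ j)
    (hμs : Summable μ) (h : ∀ (n : ℕ) (f : ℕ → ℝ), (∀ j, |f j| ≤ 1) →
      ‖∑ j ∈ Finset.range n, f j • x j‖ ^ q ≤ q * ∑ j ∈ Finset.range n, μ j * |f j|) :
    ∃ C : ℝ, ∀ (n : ℕ) (f : ℕ → ℝ), ∑ j ∈ Finset.range n, μ j * |f j| ^ s ≤ 1 →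
      ‖∑ j ∈ Finset.range n, f j • x j‖ ≤ C := by
  have hs : 0 < s := hq.trans hqs
  have h' : ∀ (n : ℕ) (f : ℕ → ℝ), (∀ j, |f j| ≤ 1) → ∀ B, ∑ j ∈ Finset.range n, μ j * |f j| ≤ B →
      ‖∑ j ∈ Finset.range n, f j • x j‖ ≤ (q * B) ^ (1 / q) := by
    intro n f hf B hB
    rw [← Real.rpow_le_rpow_iff (norm_nonneg _) _ hq]
    · have hB0 : 0 ≤ B := (Finset.sum_nonneg fun j _ => mul_nonneg (hμ j) (abs_nonneg _)).trans hB
      rw [← Real.rpow_mul (by positivity), one_div_mul_cancel hq.ne', Real.rpow_one]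
      exact (h n f hf).trans (by gcongr)
    · have hB0 : 0 ≤ B := (Finset.sum_nonneg fun j _ => mul_nonneg (hμ j) (abs_nonneg _)).trans hB
      positivity
  set ρ : ℝ := 2 ^ (1 - s / q) with hρ
  have hρ0 : 0 ≤ ρ := by positivity
  have hρ1 : ρ < 1 := by
    refine Real.rpow_lt_one_of_one_lt_of_neg one_lt_two ?_
    rw [sub_neg, one_lt_div hq]
    exact hqs
  have hlevel : ∀ (k n : ℕ) (f : ℕ → ℝ), ∑ j ∈ Finset.range n, μ j * |f j| ^ s ≤ 1 →
      (∀ j, |f j| ≤ 2 ^ k) → ‖∑ j ∈ Finset.range n, f j • x j‖ ≤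
        (q * ∑' j, μ j) ^ (1 / q) + 2 * q ^ (1 / q) * ∑ i ∈ Finset.range k, ρ ^ i := by
    intro k
    induction k with
    | zero =>
      intro n f _ hf
      simp only [pow_zero] at hf
      simp only [Finset.range_zero, Finset.sum_empty, mul_zero, add_zero]
      refine h' n f hf _ ?_
      exact (Finset.sum_le_sum fun j _ => mul_le_of_le_one_right (hμ j) (hf j)).trans
        (hμs.sum_le_tsum _ fun j _ => hμ j)
    | succ k ih =>
      intro n f hfs hf
      have hsplit : ∑ j ∈ Finset.range n, f j • x j =
          ∑ j ∈ Finset.range n, (if |f j| ≤ 2 ^ k then f j else 0) • x j +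
          (2 : ℝ) ^ (k + 1) •
            ∑ j ∈ Finset.range n, (if |f j| ≤ 2 ^ k then 0 else f j / 2 ^ (k + 1)) • x j := by
        rw [Finset.smul_sum, ← Finset.sum_add_distrib]
        refine Finset.sum_congr rfl fun j _ => ?_
        split_ifs
        · simp
        · rw [zero_smul, zero_add, smul_smul]
          congr 1
          field_simp
      have hsmall := ih n (fun j => if |f j| ≤ 2 ^ k then f j else 0) (by
        refine (Finset.sum_le_sum fun j _ => ?_).trans hfs
        refine mul_le_mul_of_nonneg_left ?_ (hμ j)
        split_ifs
        · exact le_rfl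
        · rw [abs_zero, Real.zero_rpow hs.ne']
          positivity) fun j => by
        split_ifs with hj
        · exact hj
        · simp
      have hlarge := h' n (fun j => if |f j| ≤ 2 ^ k then 0 else f j / 2 ^ (k + 1)) (fun j => by
        split_ifs
        · simp
        · rw [abs_div, abs_of_pos (show (0 : ℝ) < 2 ^ (k + 1) by positivity)]
          exact div_le_one_of_le₀ (hf j) (by positivity)) (1 / ((2 : ℝ) ^ k) ^ s) (by
        refine le_trans (b := ∑ j ∈ Finset.range n, μ j * |f j| ^ s / ((2 : ℝ) ^ k) ^ s) ?_ ?_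
        · refine Finset.sum_le_sum fun j _ => ?_
          rw [mul_div_assoc]
          refine mul_le_mul_of_nonneg_left ?_ (hμ j)
          split_ifs with hj
          · rw [abs_zero]
            positivity
          · rw [abs_div, abs_of_pos (show (0 : ℝ) < 2 ^ (k + 1) by positivity)]
            refine (div_le_one_of_le₀ (hf j) (by positivity)).trans ?_
            rw [one_le_div (by positivity)]
            exact Real.rpow_le_rpow (by positivity) (not_le.1 hj).le hs.le
        · rw [← Finset.sum_div]
          gcongr)
      have hpow : (2 : ℝ) ^ (k + 1) * (q * (1 / ((2 : ℝ) ^ k) ^ s)) ^ (1 / q) =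
          2 * q ^ (1 / q) * ρ ^ k := by
        rw [Real.mul_rpow hq.le (by positivity), one_div ((_ : ℝ) ^ s),
          ← Real.rpow_neg (by positivity), ← Real.rpow_mul (by positivity), hρ,
          ← Real.rpow_natCast (2 ^ (1 - s / q)), ← Real.rpow_mul zero_le_two,
          ← Real.rpow_natCast 2 k, ← Real.rpow_mul zero_le_two, pow_succ,
          ← Real.rpow_natCast 2 k,
          show (1 - s / q) * (k : ℝ) = k + k * (-s * (1 / q)) by ring,
          Real.rpow_add zero_lt_two]
        ring
      rw [hsplit, Finset.sum_range_succ]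
      refine (norm_add_le _ _).trans ?_
      rw [norm_smul, Real.norm_of_nonneg (by positivity)]
      have h5 := mul_le_mul_of_nonneg_left hlarge (show (0 : ℝ) ≤ 2 ^ (k + 1) by positivity)
      rw [hpow] at h5
      rw [mul_add]
      linarith
  refine ⟨(q * ∑' j, μ j) ^ (1 / q) + 2 * q ^ (1 / q) * (1 - ρ)⁻¹, fun n f hf => ?_⟩
  obtain ⟨k, hk⟩ := pow_unbounded_of_one_lt (∑ j ∈ Finset.range n, |f j|) (one_lt_two (α := ℝ))
  have hcut : ∀ j ∈ Finset.range n, (if j < n then f j else 0) = f j := fun j hj =>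
    if_pos (Finset.mem_range.1 hj)
  have h6 := hlevel k n (fun j => if j < n then f j else 0)
    (by rwa [Finset.sum_congr rfl fun j hj => by rw [hcut j hj]]) fun j => by
      split_ifs with hj
      · exact (Finset.single_le_sum (f := fun j => |f j|) (fun i _ => abs_nonneg _)
          (Finset.mem_range.2 hj)).trans hk.le
      · simp
  rw [Finset.sum_congr rfl fun j hj => by rw [hcut j hj]] at h6
  refine h6.trans ?_
  gcongr
  rw [← tsum_geometric_of_lt_one hρ0 hρ1]
  exact (summable_geometric_of_lt_one hρ0 hρ1).sum_le_tsum _ fun i _ => by positivity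

/-- The converse of Hölder's inequality for sequences. -/
lemma summable_abs_rpow_of_forall_sum_le {p s C : ℝ} (hps : p.HolderConjugate s) {z : ℕ → ℝ}
    (h : ∀ (n : ℕ) (b : ℕ → ℝ), ∑ j ∈ Finset.range n, |b j| ^ s ≤ 1 →
      |∑ j ∈ Finset.range n, b j * z j| ≤ C) : Summable fun j => |z j| ^ p := by
  refine summable_of_sum_range_le (c := C ^ p) (fun j => by positivity) fun n => ?_
  obtain ⟨⟨g, hg, hgz⟩, -⟩ := NNReal.isGreatest_Lp (Finset.range n) (fun j => ‖z j‖₊) hps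
  have h1 : ∑ j ∈ Finset.range n, |(g j : ℝ) * SignType.sign (z j)| ^ s ≤ 1 := by
    refine le_trans (Finset.sum_le_sum (g := fun j => (g j : ℝ) ^ s) fun j _ => ?_)
      (by exact_mod_cast hg)
    refine Real.rpow_le_rpow (abs_nonneg _) ?_ hps.symm.nonneg
    rw [abs_mul, NNReal.abs_eq]
    refine mul_le_of_le_one_right (g j).2 ?_
    cases SignType.sign (z j) <;> simp
  have h2 := (le_abs_self _).trans (h n _ h1)
  simp only [mul_assoc, sign_mul_self] at h2
  have h3 : (∑ j ∈ Finset.range n, |z j| ^ p) ^ (1 / p) = ∑ j ∈ Finset.range n, g j * |z j| := by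
    have := congrArg ((↑) : ℝ≥0 → ℝ) hgz
    push_cast at this
    simpa [mul_comm] using this.symm
  rw [← h3] at h2
  have h0 : 0 ≤ ∑ j ∈ Finset.range n, |z j| ^ p := Finset.sum_nonneg fun j _ => by positivity
  calc _ = ((∑ j ∈ Finset.range n, |z j| ^ p) ^ (1 / p)) ^ p := by
        rw [← Real.rpow_mul h0, one_div_mul_cancel hps.ne_zero, Real.rpow_one]
    _ ≤ _ := Real.rpow_le_rpow (by positivity) h2 hps.nonneg

/-- In a space of cotype `q`, a weakly `1`-summable sequence is the product of a sequence in `ℓ_s`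
and a weakly `s*`-summable sequence, for every `s > q`. -/
lemma HasCotype.exists_eq_smul {q p s : ℝ} {E : Type*} [NormedAddCommGroup E] [NormedSpace ℝ E]
    (h : HasCotype q E) (hps : p.HolderConjugate s) (hqs : q < s) {x : ℕ → E}
    (hx : WeaklySummable 1 x) : ∃ (α : ℕ → ℝ) (y : ℕ → E), (∀ j, 0 ≤ α j) ∧
      (Summable fun j => α j ^ s) ∧ WeaklySummable p y ∧ ∀ j, x j = α j • y j := by
  have hq : 0 < q := by linarith [h.1]
  have hs : 0 < s := hq.trans hqs
  obtain ⟨μ, hμ, hμs, hμx⟩ := h.exists_weights hx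
  obtain ⟨C, hC⟩ := exists_norm_sum_smul_le_of_weights hq hqs hμ hμs hμx
  have hα : ∀ j, (μ j ^ (1 / s)) ^ s = μ j := fun j => by
    rw [← Real.rpow_mul (hμ j), one_div_mul_cancel hs.ne', Real.rpow_one]
  refine ⟨fun j => μ j ^ (1 / s), fun j => (μ j ^ (1 / s))⁻¹ • x j,
    fun j => Real.rpow_nonneg (hμ j) _, by simpa only [hα] using hμs, fun φ => ?_, fun j => ?_⟩
  · refine summable_abs_rpow_of_forall_sum_le hps (C := ‖φ‖ * C) fun n b hb => ?_
    have h1 := hC n (fun j => b j * (μ j ^ (1 / s))⁻¹) (by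
      refine (Finset.sum_le_sum fun j _ => ?_).trans hb
      rw [abs_mul, Real.mul_rpow (abs_nonneg _) (abs_nonneg _), abs_inv,
        abs_of_nonneg (Real.rpow_nonneg (hμ j) _),
        Real.inv_rpow (Real.rpow_nonneg (hμ j) _), hα, mul_left_comm]
      exact mul_le_of_le_one_right (by positivity) mul_inv_le_one)
    have h2 : ∑ j ∈ Finset.range n, b j * φ ((μ j ^ (1 / s))⁻¹ • x j) =
        φ (∑ j ∈ Finset.range n, (b j * (μ j ^ (1 / s))⁻¹) • x j) := by
      simp only [map_sum, map_smul, smul_eq_mul, mul_assoc]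
    rw [h2]
    exact (φ.le_opNorm _).trans (mul_le_mul_of_nonneg_left h1 (norm_nonneg _))
  · rcases (hμ j).eq_or_lt with h0 | h0
    · have h1 := hμx (j + 1) (Pi.single j 1) fun i => by
        rw [Pi.single_apply]
        split_ifs <;> simp
      have h2 : ∀ i ∈ Finset.range j, (Pi.single j 1 : ℕ → ℝ) i = 0 := fun i hi =>
        Pi.single_eq_of_ne (Finset.mem_range.1 hi).ne _
      rw [Finset.sum_range_succ, Finset.sum_range_succ,
        Finset.sum_eq_zero fun i hi => by rw [h2 i hi, zero_smul],
        Finset.sum_eq_zero fun i hi => by rw [h2 i hi, abs_zero, mul_zero]] at h1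
      simp only [← h0, Pi.single_eq_same, one_smul, zero_add, zero_mul, mul_zero] at h1
      have h3 : ‖x j‖ = 0 := (Real.rpow_eq_zero (norm_nonneg _) hq.ne').1
        (h1.antisymm (by positivity))
      simp [norm_eq_zero.1 h3]
    · rw [smul_smul, mul_inv_cancel₀ (by positivity), one_smul]

/-- If `u` is `(a, p)`-summing on a space of cotype `q < p*`, then `u` is `(b, 1)`-summing with
`1 - 1 / b = 1 / p - 1 / a`. -/
lemma AbsolutelySumming.of_hasCotype {E F : Type*} [NormedAddCommGroup E] [NormedSpace ℝ E]
    [NormedAddCommGroup F] [NormedSpace ℝ F] {u : E →L[ℝ] F} {q p s a b : ℝ}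
    (h : HasCotype q E) (hps : p.HolderConjugate s) (hqs : q < s) (ha : 0 < a)
    (hab : 1 / s + 1 / a = 1 / b) (hu : AbsolutelySumming a p u) : AbsolutelySumming b 1 u := by
  intro x hx
  obtain ⟨α, y, hα, hαs, hy, hxy⟩ := h.exists_eq_smul hps hqs hx
  refine (Real.summable_Lr_of_Lp_Lq_of_nonneg (show s.HolderTriple a b from
    ⟨by simpa only [one_div] using hab, hps.symm.pos, ha⟩) hα (fun j => norm_nonneg (u (y j)))
    hαs (hu y hy)).congr fun j => ?_
  rw [hxy, map_smul, norm_smul, Real.norm_of_nonneg (hα j)]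

lemma exists_hasCotype_of_lt_conjE {E : Type*} [NormedAddCommGroup E] [NormedSpace ℝ E] {p s : ℝ}
    (hps : p.HolderConjugate s) (hp : ENNReal.ofReal p < conjE (cot E)) :
    ∃ q, q < s ∧ HasCotype q E := by
  have hp1 : 0 < p - 1 := by linarith [hps.lt]
  have h1 : cot E < ENNReal.ofReal s := by
    by_contra! hle
    refine hp.not_ge ?_
    have hs1 : 0 < s - 1 := by linarith [hps.symm.lt]
    have e : p = 1 + 1 / (s - 1) := by
      have := hps.symm.conjugate_eq
      rw [this]
      field_simp
      ring
    rw [conjE, e, ENNReal.ofReal_add zero_le_one (by positivity), ENNReal.ofReal_one,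
      ENNReal.ofReal_div_of_pos hs1, ENNReal.ofReal_one]
    gcongr
    rw [ENNReal.ofReal_sub _ zero_le_one, ENNReal.ofReal_one]
    gcongr
  obtain ⟨_, ⟨q, hq, rfl⟩, hlt⟩ := sInf_lt_iff.1 h1
  exact ⟨q, (ENNReal.ofReal_lt_ofReal_iff hps.symm.pos).1 hlt, hq⟩

/-- strings of coincidences, general case. -/
theorem stmt8 (E F : Type*) [NormedAddCommGroup E] [NormedSpace ℝ E] [CompleteSpace E]
    [NormedAddCommGroup F] [NormedSpace ℝ F] [CompleteSpace F]
    (hE : ¬ FiniteDimensional ℝ E) (hF : ¬ FiniteDimensional ℝ F)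
    (r r₁ a a₁ : ℝ) (hr : 1 ≤ r) (hrr : r ≤ r₁)
    (hr₁ : ENNReal.ofReal r₁ < conjE (cot E))
    (hra : r ≤ a) (haa : a ≤ a₁)
    (heq : 1 / r - 1 / a = 1 / r₁ - 1 / a₁) (u : E →L[ℝ] F) :
    AbsolutelySumming a r u ↔ AbsolutelySumming a₁ r₁ u := by
  have hr0 : 0 < r := by linarith
  have hr₁0 : 0 < r₁ := by linarith
  have ha0 : 0 < a := by linarith
  have ha₁0 : 0 < a₁ := by linarith
  refine ⟨fun hu => hu.mono hr0 hrr ha0 ha₁0 heq, fun hu => ?_⟩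
  rcases (hr.trans hrr).eq_or_lt with h1 | h1
  · obtain rfl : r = r₁ := by linarith
    obtain rfl : a = a₁ := by simpa using heq
    exact hu
  · have hps := Real.HolderConjugate.conjExponent h1
    obtain ⟨q, hqs, hq⟩ := exists_hasCotype_of_lt_conjE hps hr₁
    have hs := hps.symm.pos
    have hsum : 1 / r₁ + 1 / r₁.conjExponent = 1 := by
      simpa only [one_div] using hps.inv_add_inv_eq_one
    refine (hu.of_hasCotype hq hps hqs ha₁0 (one_div_one_div _).symm).mono one_pos hr
      (by positivity) ha0 ?_
    rw [one_div_one_div]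
    linarith

end
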